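/- There does not exist a regular (225, 112, 55, 56)-partial difference set in any abelian group of order 225. -/

import Mathlib

open Finset

variable {G : Type*} [CommGroup G] [Fintype G] [DecidableEq G]

/-- `D` is a `(v,k,l,m)`-partial difference set in `G`: every non-identity element of `D`
has exactly `l` representations as `d₁ * d₂⁻¹` with `d₁ ≠ d₂` in `D`, and every
non-identity element not in `D` has exactly `m` such representations. -/
def IsPDS (D : Finset G) (v k l m : ℕ) : Prop :=
  Fintype.card G = v ∧ D.card = k ∧
  (∀ g : G, g ≠ 1 → g ∈ D →
    ((D ×ˢ D).filter (fun x => x.1 ≠ x.2 ∧ x.1 * x.2⁻¹ = g)).card = l) ∧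
  (∀ g : G, g ≠ 1 → g ∉ D →
    ((D ×ˢ D).filter (fun x => x.1 ≠ x.2 ∧ x.1 * x.2⁻¹ = g)).card = m)

/-- A regular PDS: additionally `D⁽⁻¹⁾ = D` and `1 ∉ D`. -/
def IsRegularPDS (D : Finset G) (v k l m : ℕ) : Prop :=
  IsPDS D v k l m ∧ (∀ d : G, d ∈ D ↔ d⁻¹ ∈ D) ∧ (1 : G) ∉ D

/-- A regular Paley type PDS: a regular `(v, (v-1)/2, (v-5)/4, (v-1)/4)`-PDS,
encoded without division as `v = 2k+1`, `v = 4l+5`, `v = 4m+1`. -/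
def IsPaleyPDS (D : Finset G) : Prop :=
  ∃ k l m : ℕ, IsRegularPDS D (Fintype.card G) k l m ∧
    Fintype.card G = 2 * k + 1 ∧ Fintype.card G = 4 * l + 5 ∧ Fintype.card G = 4 * m + 1

theorem aux_pow_gcd (hG : Fintype.card G = 225) (g : G) (n : ℕ) (h : g ^ n = 1) :
    g ^ (Nat.gcd n 225) = 1 := by
  have h2 : g ^ 225 = 1 := by rw [← hG]; exact pow_card_eq_one
  exact orderOf_dvd_iff_pow_eq_one.mp
    (Nat.dvd_gcd (orderOf_dvd_of_pow_eq_one h) (orderOf_dvd_of_pow_eq_one h2))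

theorem aux_pow_mod (hG : Fintype.card G = 225) (g : G) (m n : ℕ) (h : m % 225 = n % 225) :
    g ^ m = g ^ n := by
  have := pow_mod_card g m
  have h2 := pow_mod_card g n
  rw [hG] at this h2
  rw [← this, ← h2, h]

/-- closure of `D` under square roots -/
theorem aux_sqrt (hG : Fintype.card G = 225) (D : Finset G)
    (hD : IsRegularPDS D 225 112 55 56) (g : G) (hg : g ∈ D) : g ^ 113 ∈ D := by
  obtain ⟨⟨_, hk, hl, hm⟩, hinv, h1⟩ := hD
  have hg1 : g ≠ 1 := fun h => h1 (h ▸ hg)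
  by_contra hno
  have key := hl g hg1 hg
  have : (∑ _x ∈ (D ×ˢ D).filter (fun x => x.1 ≠ x.2 ∧ x.1 * x.2⁻¹ = g), (1 : ZMod 2)) = 0 := by
    refine Finset.sum_involution (fun x _ => (x.2⁻¹, x.1⁻¹)) ?_ ?_ ?_ ?_
    · intros; decide
    · rintro ⟨a, b⟩ hx _ heq
      simp only [mem_filter, mem_product, Prod.mk.injEq] at hx heq
      apply hno
      have : g = a ^ 2 := by rw [← hx.2.2, heq.1, sq]
      rw [this, ← pow_mul, aux_pow_mod hG a (2 * 113) 1 (by norm_num), pow_one]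
      exact hx.1.1
    · rintro ⟨a, b⟩ hx
      simp only [mem_filter, mem_product] at hx ⊢
      refine ⟨⟨(hinv b).1 hx.1.2, (hinv a).1 hx.1.1⟩, ?_, ?_⟩
      · intro h; exact hx.2.1 (inv_injective h).symm
      · rw [inv_inv, mul_comm]; exact hx.2.2
    · rintro ⟨a, b⟩ hx
      simp
  rw [Finset.sum_const, key] at this
  revert this
  decide

theorem aux_mult (hG : Fintype.card G = 225) (D : Finset G)
    (hD : IsRegularPDS D 225 112 55 56) (g : G) (hg : g ∈ D) : g ^ 118 ∈ D := by
  have h : ∀ n : ℕ, g ^ (113 ^ n) ∈ D := by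
    intro n
    induction n with
    | zero => simpa using hg
    | succ n ih => rw [pow_succ, pow_mul]; exact aux_sqrt hG D hD _ ih
  obtain ⟨N, hN, hgN⟩ : ∃ N : ℕ, N % 225 = 107 ∧ g ^ N ∈ D := ⟨113 ^ 15, by norm_num, h 15⟩
  have h2 := (hD.2.1 _).1 hgN
  have : (g ^ N)⁻¹ = g ^ 118 := by
    rw [inv_eq_iff_mul_eq_one, ← pow_add, aux_pow_mod hG g _ 0 (by omega), pow_zero]
  rwa [this] at h2

theorem aux_four {α : Type*} [DecidableEq α] (S : Finset α) (s : α → α)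
    (hS : ∀ a ∈ S, s a ∈ S) (h4 : ∀ a ∈ S, s (s (s (s a))) = a)
    (h2 : ∀ a ∈ S, s (s a) ≠ a) : 4 ∣ S.card := by
  induction hn : S.card using Nat.strong_induction_on generalizing S with
  | _ n ih =>
  rcases S.eq_empty_or_nonempty with rfl | ⟨a, ha⟩
  · simp at hn; simp [← hn]
  · have hb := hS a ha
    have hc := hS _ hb
    have hd := hS _ hc
    have e4 := h4 a ha
    have e2 := h2 a ha
    have e2b := h2 _ hb
    have e1 : s a ≠ a := fun h => e2 (by rw [h, h])
    have hsub : ({a, s a, s (s a), s (s (s a))} : Finset α) ⊆ S := by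
      intro x hx
      simp only [mem_insert, mem_singleton] at hx
      rcases hx with rfl | rfl | rfl | rfl <;> assumption
    have e3 : s (s (s a)) ≠ a := fun h => by
      rw [h] at e4; exact e1 e4
    have e1b : s (s a) ≠ s a := fun h => by
      rw [h] at e3; exact e2 (by rw [h] ; rw [h] at e3; exact absurd (by rw [h, h, h] at e4; exact e4) e1)
    have e1c : s (s (s a)) ≠ s (s a) := fun h => by
      rw [h] at e4
      rw [h] at e4; exact e2 e4
    have hcard : ({a, s a, s (s a), s (s (s a))} : Finset α).card = 4 := by
      rw [card_insert_of_notMem, card_insert_of_notMem, card_insert_of_notMem, card_singleton]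
      · simp [e1c.symm]
      · simp [e1b.symm, e2b.symm]
      · simp [e1.symm, e2.symm, e3.symm]
    have hc2 := card_sdiff_add_card_eq_card hsub
    have := ih (S \ {a, s a, s (s a), s (s (s a))}).card (by omega)
      (S \ {a, s a, s (s a), s (s (s a))}) ?_ ?_ ?_ rfl
    · omega
    · intro x hx
      simp only [mem_sdiff, mem_insert, mem_singleton, not_or] at hx ⊢
      obtain ⟨hx, n1, n2, n3, n4⟩ := hx
      have ex := h4 x hx
      refine ⟨hS x hx, ?_, ?_, ?_, ?_⟩
      · intro h; rw [h] at ex; exact n4 ex.symm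
      · intro h; rw [h, e4] at ex; exact n1 ex.symm
      · intro h; rw [h, e4] at ex; exact n2 ex.symm
      · intro h; rw [h, e4] at ex; exact n3 ex.symm
    · intro x hx; exact h4 x (mem_sdiff.1 hx).1
    · intro x hx; exact h2 x (mem_sdiff.1 hx).1

section Fibres

variable {A : Type*} [CommGroup A] [Fintype A] [DecidableEq A]

/-- size of the part of `D` lying over `a` -/
def fib (D : Finset G) (φ : G →* A) (a : A) : ℕ := (D.filter (fun g => φ g = a)).card

theorem fib_sum (D : Finset G) (φ : G →* A) : ∑ a, fib D φ a = D.card :=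
  (card_eq_sum_card_fiberwise (fun _ _ => mem_coe.2 (mem_univ _))).symm

theorem fib_inv (D : Finset G) (hinv : ∀ d : G, d ∈ D ↔ d⁻¹ ∈ D) (φ : G →* A) (a : A) :
    fib D φ a⁻¹ = fib D φ a := by
  unfold fib
  refine card_bij (fun g _ => g⁻¹) ?_ ?_ ?_
  · intro g hg
    simp only [mem_filter, map_inv] at hg ⊢
    exact ⟨(hinv g).1 hg.1, by rw [hg.2, inv_inv]⟩
  · intro g _ h _ e; exact inv_injective e
  · intro g hg
    simp only [mem_filter] at hg
    exact ⟨g⁻¹, by simp only [mem_filter, map_inv]; exact ⟨(hinv g).1 hg.1, by rw [hg.2]⟩,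
      inv_inv g⟩

theorem fib_sq (D : Finset G) (hD : IsRegularPDS D 225 112 55 56) (φ : G →* A) :
    ∑ a, fib D φ a ^ 2 + fib D φ 1 =
      56 + 56 * ((univ : Finset G).filter (fun g => φ g = 1)).card := by
  obtain ⟨⟨_, hk, hl, hm⟩, hinv, h1⟩ := hD
  have e1 : ∑ a, fib D φ a ^ 2 = ((D ×ˢ D).filter (fun x => φ (x.1 * x.2⁻¹) = 1)).card := by
    rw [card_eq_sum_card_fiberwise (f := fun x => φ x.1) (t := univ)
      (fun _ _ => mem_coe.2 (mem_univ _))]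
    refine sum_congr rfl fun a _ => ?_
    rw [sq, fib, ← card_product]
    congr 1
    ext ⟨x, y⟩
    simp only [mem_filter, mem_product, map_mul, map_inv, mul_inv_eq_one]
    constructor
    · rintro ⟨⟨hx, hx'⟩, hy, hy'⟩; exact ⟨⟨⟨hx, hy⟩, hx'.trans hy'.symm⟩, hx'⟩
    · rintro ⟨⟨⟨hx, hy⟩, h⟩, hx'⟩; exact ⟨⟨hx, hx'⟩, hy, h ▸ hx'⟩
  have e2 : ((D ×ˢ D).filter (fun x => φ (x.1 * x.2⁻¹) = 1)).card =
      ∑ g ∈ (univ : Finset G).filter (fun g => φ g = 1),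
        ((D ×ˢ D).filter (fun x => x.1 * x.2⁻¹ = g)).card := by
    rw [card_eq_sum_card_fiberwise (f := fun x => x.1 * x.2⁻¹)
      (t := (univ : Finset G).filter (fun g => φ g = 1))]
    · refine sum_congr rfl fun g hg => ?_
      congr 1
      ext ⟨x, y⟩
      simp only [mem_filter, mem_univ, true_and] at hg ⊢
      constructor
      · rintro ⟨⟨h, _⟩, h3⟩; exact ⟨h, h3⟩
      · rintro ⟨h, h3⟩; exact ⟨⟨h, by rw [h3, hg]⟩, h3⟩
    · intro x hx
      simpa using (mem_filter.1 hx).2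
  have e3 : ∀ g : G, ((D ×ˢ D).filter (fun x => x.1 * x.2⁻¹ = g)).card +
      (if g ∈ D then 1 else 0) = 56 + if g = 1 then 56 else 0 := by
    intro g
    by_cases hg : g = 1
    · subst hg
      rw [if_neg h1, if_pos rfl]
      have : (D ×ˢ D).filter (fun x => x.1 * x.2⁻¹ = 1) = D.diag := by
        ext ⟨x, y⟩
        simp only [mem_filter, mem_product, mul_inv_eq_one, mem_diag]
        constructor
        · rintro ⟨⟨h, _⟩, h3⟩; exact ⟨h, h3⟩
        · rintro ⟨h, rfl⟩; exact ⟨⟨h, h⟩, rfl⟩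
      rw [this, diag_card, hk]
    · have : (D ×ˢ D).filter (fun x => x.1 * x.2⁻¹ = g) =
          (D ×ˢ D).filter (fun x => x.1 ≠ x.2 ∧ x.1 * x.2⁻¹ = g) := by
        refine filter_congr fun x _ => ?_
        constructor
        · intro h; exact ⟨fun h' => hg (by rw [← h, h', mul_inv_cancel]), h⟩
        · exact fun h => h.2
      rw [this, if_neg hg]
      by_cases hgD : g ∈ D
      · rw [hl g hg hgD, if_pos hgD]
      · rw [hm g hg hgD, if_neg hgD]
  have e4 : fib D φ 1 =
      ∑ g ∈ (univ : Finset G).filter (fun g => φ g = 1), if g ∈ D then 1 else 0 := by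
    rw [← card_filter, fib]
    congr 1
    ext g
    simp [and_comm]
  rw [e1, e2, e4, ← sum_add_distrib, sum_congr rfl (fun g _ => e3 g), sum_add_distrib,
    sum_const, smul_eq_mul, sum_ite_eq', if_pos (by simp)]
  ring

theorem ker_card (φ : G →* A) (hφ : Function.Surjective φ) :
    Fintype.card A * ((univ : Finset G).filter (fun g => φ g = 1)).card = Fintype.card G := by
  have e := card_eq_sum_card_fiberwise (s := (univ : Finset G)) (f := φ) (t := univ)
      (fun _ _ => mem_coe.2 (mem_univ _))
  rw [card_univ] at e
  rw [e, ← card_univ (α := A)]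
  symm
  apply sum_const_nat
  intro a _
  obtain ⟨g, rfl⟩ := hφ a
  refine card_bij (fun x _ => x * g⁻¹) ?_ ?_ ?_
  · intro x hx
    simp only [mem_filter, mem_univ, true_and] at hx
    simp [hx]
  · intro x _ y _ e; exact mul_right_cancel e
  · intro x hx
    simp only [mem_filter, mem_univ, true_and] at hx
    exact ⟨x * g, by simp [hx], by simp⟩

theorem fib_mod (hG : Fintype.card G = 225) (D : Finset G)
    (hD : IsRegularPDS D 225 112 55 56) (φ : G →* A) (hφ : Function.Surjective φ)
    (hA : Fintype.card A = 9) (hker : ∀ g : G, φ g = 1 → g ^ 25 = 1) :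
    (∀ a, fib D φ a % 4 ≤ 1) ∧ fib D φ 1 % 4 = 0 := by
  have hsplit : ∀ a, fib D φ a = ((D.filter (fun g => φ g = a)).filter (fun g => g ^ 9 = 1)).card
      + ((D.filter (fun g => φ g = a)).filter (fun g => ¬ g ^ 9 = 1)).card := fun a =>
    (card_filter_add_card_filter_not _).symm
  have h4 : ∀ a, 4 ∣ ((D.filter (fun g => φ g = a)).filter (fun g => ¬ g ^ 9 = 1)).card := by
    intro a
    refine aux_four _ (fun g => g ^ 118) ?_ ?_ ?_
    · intro g hg
      simp only [mem_filter] at hg ⊢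
      refine ⟨⟨aux_mult hG D hD g hg.1.1, ?_⟩, ?_⟩
      · rw [map_pow, hg.1.2]
        have : a ^ 9 = 1 := by rw [← hA]; exact pow_card_eq_one
        calc a ^ 118 = (a ^ 9) ^ 13 * a := by rw [← pow_mul, ← pow_succ]
          _ = a := by rw [this, one_pow, one_mul]
      · intro h
        rw [← pow_mul] at h
        exact hg.2 (aux_pow_gcd hG g _ h)
    · intro g _
      simp only [← pow_mul]
      rw [aux_pow_mod hG g _ 1 (by norm_num), pow_one]
    · intro g hg h
      simp only [mem_filter] at hg
      apply hg.2
      simp only [← pow_mul] at h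
      have h' : g ^ (117 * 119) = 1 := by
        have : g ^ (117 * 119) * g = 1 * g := by rw [← pow_succ, one_mul]; exact h
        exact mul_right_cancel this
      exact aux_pow_gcd hG g _ h'
  have hz : ∀ g : G, g ^ 9 = 1 → φ g = 1 → g = 1 := by
    intro g h9 h
    have h25 := hker g h
    have h' := orderOf_dvd_iff_pow_eq_one.mp
      (Nat.dvd_gcd (orderOf_dvd_of_pow_eq_one h9) (orderOf_dvd_of_pow_eq_one h25))
    have : Nat.gcd 9 25 = 1 := by norm_num
    rwa [this, pow_one] at h'
  constructor
  · intro a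
    have hle : ((D.filter (fun g => φ g = a)).filter (fun g => g ^ 9 = 1)).card ≤ 1 := by
      refine card_le_one.2 fun x hx y hy => ?_
      simp only [mem_filter] at hx hy
      have := hz (x * y⁻¹) (by rw [mul_pow, inv_pow, hx.2, hy.2]; simp)
        (by rw [map_mul, map_inv, hx.1.2, hy.1.2, mul_inv_cancel])
      exact mul_inv_eq_one.1 this
    have := hsplit a
    have := h4 a
    omega
  · have h0 : ((D.filter (fun g => φ g = 1)).filter (fun g => g ^ 9 = 1)).card = 0 := by
      rw [card_eq_zero, filter_eq_empty_iff]
      intro g hg h9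
      rw [mem_filter] at hg
      exact hD.2.2 (hz g h9 hg.2 ▸ hg.1)
    have := hsplit 1
    have := h4 1
    omega

theorem pair_step (hodd : ∀ p : A, p ≠ 1 → p⁻¹ ≠ p) (S : Finset A)
    (hS : ∀ p ∈ S, p ≠ 1 ∧ p⁻¹ ∈ S) (hne : 0 < S.card) :
    ∃ p ∈ S, ∃ T : Finset A, (∀ p ∈ T, p ≠ 1 ∧ p⁻¹ ∈ T) ∧ T.card + 2 = S.card ∧
      ∀ F : A → ℕ, (∀ a, F a⁻¹ = F a) → ∑ a ∈ S, F a = 2 * F p + ∑ a ∈ T, F a := by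
  obtain ⟨p, hp⟩ := card_pos.1 hne
  have hne := hodd p (hS p hp).1
  have hp' : p⁻¹ ∈ S.erase p := mem_erase.2 ⟨hne, (hS p hp).2⟩
  refine ⟨p, hp, (S.erase p).erase p⁻¹, ?_, ?_, ?_⟩
  · intro q hq
    simp only [mem_erase] at hq ⊢
    refine ⟨(hS q hq.2.2).1, ?_, ?_, (hS q hq.2.2).2⟩
    · intro h; exact hq.2.1 (inv_injective h)
    · intro h; exact hq.1 (by rw [← h, inv_inv])
  · have h1 := card_erase_add_one hp
    have h2 := card_erase_add_one hp'
    omega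
  · intro F hF
    rw [← add_sum_erase _ _ hp, ← add_sum_erase _ _ hp', hF]
    ring

theorem odd_inv (hodd : Odd (Fintype.card A)) (p : A) (hp : p ≠ 1) : p⁻¹ ≠ p := by
  intro h
  have h2 : p ^ 2 = 1 := by
    rw [sq]; nth_rw 1 [← h]; exact inv_mul_cancel p
  apply hp
  obtain ⟨m, hm⟩ := hodd
  have : p ^ Fintype.card A = 1 := pow_card_eq_one
  rw [hm, pow_succ, pow_mul, h2, one_pow, one_mul] at this
  exact this

theorem base_pair : ∀ p ∈ (univ : Finset A).erase 1, p ≠ 1 ∧ p⁻¹ ∈ (univ : Finset A).erase 1 := by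
  intro p hp
  simpa using hp

theorem pair_nine (hA : Fintype.card A = 9) : ∃ p1 p2 p3 p4 : A,
    ∀ F : A → ℕ, (∀ a, F a⁻¹ = F a) →
      ∑ a, F a = F 1 + 2 * (F p1 + F p2 + F p3 + F p4) := by
  have hodd := odd_inv (A := A) (by rw [hA]; decide)
  have h1 := card_erase_add_one (mem_univ (1 : A))
  rw [card_univ, hA] at h1
  obtain ⟨p1, -, T1, hT1, c1, s1⟩ := pair_step hodd _ base_pair (by omega)
  obtain ⟨p2, -, T2, hT2, c2, s2⟩ := pair_step hodd _ hT1 (by omega)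
  obtain ⟨p3, -, T3, hT3, c3, s3⟩ := pair_step hodd _ hT2 (by omega)
  obtain ⟨p4, -, T4, hT4, c4, s4⟩ := pair_step hodd _ hT3 (by omega)
  have : T4 = ∅ := card_eq_zero.1 (by omega)
  refine ⟨p1, p2, p3, p4, fun F hF => ?_⟩
  rw [← add_sum_erase _ _ (mem_univ (1 : A)), s1 F hF, s2 F hF, s3 F hF, s4 F hF, this, sum_empty]
  ring

theorem pair_three (hA : Fintype.card A = 3) : ∃ p : A,
    ∀ F : A → ℕ, (∀ a, F a⁻¹ = F a) → ∑ a, F a = F 1 + 2 * F p := by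
  have hodd := odd_inv (A := A) (by rw [hA]; decide)
  have h1 := card_erase_add_one (mem_univ (1 : A))
  rw [card_univ, hA] at h1
  obtain ⟨p1, -, T1, hT1, c1, s1⟩ := pair_step hodd _ base_pair (by omega)
  have : T1 = ∅ := card_eq_zero.1 (by omega)
  refine ⟨p1, fun F hF => ?_⟩
  rw [← add_sum_erase _ _ (mem_univ (1 : A)), s1 F hF, this, sum_empty]
  ring

end Fibres

theorem arith_three (u v : ℕ) (h1 : u + 2 * v = 112) (h2 : u ^ 2 + 2 * v ^ 2 + u = 4256) :
    u = 32 ∨ u = 42 := by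
  have hv : v ≤ 56 := by omega
  obtain rfl : u = 112 - 2 * v := by omega
  interval_cases v <;> simp_all

theorem arith_nine (x a b c d : ℕ) (hx : x % 4 = 0) (ha : a % 4 ≤ 1) (hb : b % 4 ≤ 1)
    (hc : c % 4 ≤ 1) (hd : d % 4 ≤ 1) (h1 : x + 2 * (a + b + c + d) = 112)
    (h2 : x ^ 2 + 2 * (a ^ 2 + b ^ 2 + c ^ 2 + d ^ 2) + x = 1456) : x = 12 := by
  have hsq : ∀ z : ℕ, z % 4 ≤ 1 → ∃ k r, r ≤ 1 ∧ z = 4 * k + r ∧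
      z ^ 2 = 16 * k ^ 2 + 8 * (k * r) + r ∧ ∃ j, k ^ 2 = k + 2 * j := by
    intro z hz
    refine ⟨z / 4, z % 4, hz, by omega, ?_, ?_⟩
    · have h : z = 4 * (z / 4) + z % 4 := by omega
      have hr : (z % 4) ^ 2 = z % 4 := by
        generalize z % 4 = r at hz ⊢
        interval_cases r <;> rfl
      calc z ^ 2 = (4 * (z / 4) + z % 4) ^ 2 := by rw [← h]
        _ = 16 * (z / 4) ^ 2 + 8 * (z / 4 * (z % 4)) + (z % 4) ^ 2 := by ring
        _ = _ := by rw [hr]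
    · generalize z / 4 = k
      rcases k with _ | k
      · exact ⟨0, rfl⟩
      · obtain ⟨j, hj⟩ := Nat.even_mul_succ_self k
        exact ⟨j, by nlinarith⟩
  have hlo : 9 * (x : ℤ) ^ 2 + 896 ≤ 216 * x := by
    have h1' : (x : ℤ) + 2 * (a + b + c + d) = 112 := by exact_mod_cast h1
    have h2' : (x : ℤ) ^ 2 + 2 * (a ^ 2 + b ^ 2 + c ^ 2 + d ^ 2) + x = 1456 := by exact_mod_cast h2
    have hx' : (x : ℤ) = 112 - 2 * (a + b + c + d) := by linarith
    have hcs : ((a : ℤ) + b + c + d) ^ 2 ≤ 4 * (a ^ 2 + b ^ 2 + c ^ 2 + d ^ 2) := by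
      nlinarith [sq_nonneg ((a : ℤ) - b), sq_nonneg ((a : ℤ) - c), sq_nonneg ((a : ℤ) - d),
        sq_nonneg ((b : ℤ) - c), sq_nonneg ((b : ℤ) - d), sq_nonneg ((c : ℤ) - d)]
    have hs : ((a : ℤ) + b + c + d) = (112 - x) / 2 := by omega
    have hs2 : 4 * ((a : ℤ) + b + c + d) ^ 2 = (112 - x) ^ 2 := by
      rw [hx']; ring
    nlinarith
  have hx5 : 5 ≤ x := by
    by_contra h
    have : x ≤ 4 := by omega
    interval_cases x <;> norm_num at hlo
  have hx19 : x < 19 := by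
    by_contra h
    have : (19 : ℤ) ≤ x := by exact_mod_cast (by omega : 19 ≤ x)
    nlinarith
  obtain ⟨k1, r1, hr1, rfl, e1, j1, m1⟩ := hsq a ha
  obtain ⟨k2, r2, hr2, rfl, e2, j2, m2⟩ := hsq b hb
  obtain ⟨k3, r3, hr3, rfl, e3, j3, m3⟩ := hsq c hc
  obtain ⟨k4, r4, hr4, rfl, e4, j4, m4⟩ := hsq d hd
  rw [e1, e2, e3, e4, m1, m2, m3, m4] at h2
  clear e1 e2 e3 e4 hsq hlo m1 m2 m3 m4 ha hb hc hd
  have : x = 8 ∨ x = 12 ∨ x = 16 := by omega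
  rcases this with rfl | h | rfl
  · exfalso
    have hR : r1 + r2 + r3 + r4 = 4 := by
      clear h1 hx hx5 hx19
      generalize k1 * r1 = a1 at h2
      generalize k2 * r2 = a2 at h2
      generalize k3 * r3 = a3 at h2
      generalize k4 * r4 = a4 at h2
      obtain ⟨R, hR⟩ : ∃ R, R = r1 + r2 + r3 + r4 := ⟨_, rfl⟩
      obtain ⟨K, hK⟩ : ∃ K, K = 2 * (k1 + 2 * j1 + (k2 + 2 * j2) + (k3 + 2 * j3) + (k4 + 2 * j4))
        + (a1 + a2 + a3 + a4) := ⟨_, rfl⟩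
      have hR4 : R ≤ 4 := by linarith
      have h3 : 8 ^ 2 + 2 * (8 * K + R) + 8 = 1456 := by rw [← h2, hR, hK]; ring
      clear h2
      rw [← hR]
      clear hR hK
      omega
    obtain rfl : r1 = 1 := by clear h1 h2; omega
    obtain rfl : r2 = 1 := by clear h1 h2; omega
    obtain rfl : r3 = 1 := by clear h1 h2; omega
    obtain rfl : r4 = 1 := by clear h1 h2; omega
    obtain ⟨K, hK⟩ : ∃ K, K = k1 + k2 + k3 + k4 := ⟨_, rfl⟩
    obtain ⟨J, hJ⟩ : ∃ J, J = j1 + j2 + j3 + j4 := ⟨_, rfl⟩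
    have h3 : 8 + 2 * (4 * K + 4) = 112 := by rw [← h1, hK]; ring
    have h4 : 8 ^ 2 + 2 * (16 * (K + 2 * J) + 8 * (K * 1) + 4) + 8 = 1456 := by
      rw [← h2, hK, hJ]; ring
    clear h1 h2 hK hJ
    omega
  · exact h
  · exfalso
    have hR : r1 + r2 + r3 + r4 = 0 := by
      clear h1 hx hx5 hx19
      generalize k1 * r1 = a1 at h2
      generalize k2 * r2 = a2 at h2
      generalize k3 * r3 = a3 at h2
      generalize k4 * r4 = a4 at h2
      obtain ⟨R, hR⟩ : ∃ R, R = r1 + r2 + r3 + r4 := ⟨_, rfl⟩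
      obtain ⟨K, hK⟩ : ∃ K, K = 2 * (k1 + 2 * j1 + (k2 + 2 * j2) + (k3 + 2 * j3) + (k4 + 2 * j4))
        + (a1 + a2 + a3 + a4) := ⟨_, rfl⟩
      have hR4 : R ≤ 4 := by linarith
      have h3 : 16 ^ 2 + 2 * (8 * K + R) + 16 = 1456 := by rw [← h2, hR, hK]; ring
      clear h2
      rw [← hR]
      clear hR hK
      omega
    obtain rfl : r1 = 0 := by clear h1 h2; omega
    obtain rfl : r2 = 0 := by clear h1 h2; omega
    obtain rfl : r3 = 0 := by clear h1 h2; omega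
    obtain rfl : r4 = 0 := by clear h1 h2; omega
    obtain ⟨K, hK⟩ : ∃ K, K = k1 + k2 + k3 + k4 := ⟨_, rfl⟩
    obtain ⟨J, hJ⟩ : ∃ J, J = j1 + j2 + j3 + j4 := ⟨_, rfl⟩
    have h3 : 16 + 2 * (4 * K + 0) = 112 := by rw [← h1, hK]; ring
    have h4 : 16 ^ 2 + 2 * (16 * (K + 2 * J) + 8 * (K * 0) + 0) + 16 = 1456 := by
      rw [← h2, hK, hJ]; ring
    clear h1 h2 hK hJ
    omega

theorem main_aux (hG : Fintype.card G = 225) (D : Finset G)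
    (hD : IsRegularPDS D 225 112 55 56)
    {A : Type*} [CommGroup A] [Fintype A] [DecidableEq A]
    {B : Type*} [CommGroup B] [Fintype B] [DecidableEq B]
    (φ : G →* A) (hφ : Function.Surjective φ) (ψ : A →* B) (hψ : Function.Surjective ψ)
    (hA : Fintype.card A = 9) (hB : Fintype.card B = 3) (p : A) (hp : p ≠ 1)
    (hker : ∀ g : G, φ g = 1 → g ^ 25 = 1)
    (hkp : ∀ a : A, ψ a = 1 ↔ a = 1 ∨ a = p ∨ a = p⁻¹) : False := by
  have hinv := hD.2.1
  have hk := hD.1.2.1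
  obtain ⟨hm, hm1⟩ := fib_mod hG D hD φ hφ hA hker
  have hx : fib D φ 1 = 12 := by
    obtain ⟨p1, p2, p3, p4, hF⟩ := pair_nine hA
    have s1 := fib_sum D φ
    rw [hF _ (fib_inv D hinv φ), hk] at s1
    have s2 := fib_sq D hD φ
    have kc := ker_card φ hφ
    rw [hA, hG] at kc
    rw [hF (fun a => fib D φ a ^ 2) (fun a => by rw [fib_inv D hinv φ])] at s2
    generalize ((univ : Finset G).filter (fun g => φ g = 1)).card = N at kc s2
    obtain rfl : N = 25 := by clear s1 s2; omega
    norm_num at s2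
    exact arith_nine _ _ _ _ _ hm1 (hm p1) (hm p2) (hm p3) (hm p4) s1 s2
  have hu : fib D (ψ.comp φ) 1 = 32 ∨ fib D (ψ.comp φ) 1 = 42 := by
    obtain ⟨q, hF⟩ := pair_three hB
    have s1 := fib_sum D (ψ.comp φ)
    rw [hF _ (fib_inv D hinv _), hk] at s1
    have s2 := fib_sq D hD (ψ.comp φ)
    have kc := ker_card (ψ.comp φ) (hψ.comp hφ)
    rw [hB, hG] at kc
    rw [hF (fun a => fib D (ψ.comp φ) a ^ 2) (fun a => by rw [fib_inv D hinv _])] at s2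
    generalize ((univ : Finset G).filter (fun g => (ψ.comp φ) g = 1)).card = N at kc s2
    obtain rfl : N = 75 := by clear s1 s2; omega
    norm_num at s2
    exact arith_three _ _ s1 s2
  have hodd := odd_inv (A := A) (by rw [hA]; decide) p hp
  have hsum : fib D (ψ.comp φ) 1 = fib D φ 1 + 2 * fib D φ p := by
    have : fib D (ψ.comp φ) 1 = ∑ a ∈ ({1, p, p⁻¹} : Finset A), fib D φ a := by
      unfold fib
      rw [card_eq_sum_card_fiberwise (f := φ) (t := {1, p, p⁻¹})]
      · refine sum_congr rfl fun a ha => ?_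
        congr 1
        ext g
        simp only [mem_filter, MonoidHom.comp_apply, mem_insert, mem_singleton] at ha ⊢
        constructor
        · rintro ⟨⟨h, _⟩, h3⟩; exact ⟨h, h3⟩
        · rintro ⟨h, rfl⟩; exact ⟨⟨h, (hkp _).2 ha⟩, rfl⟩
      · intro g hg
        have := (hkp (φ g)).1 (mem_filter.1 hg).2
        simpa using this
    rw [this, sum_insert, sum_insert, sum_singleton, fib_inv D hinv]
    · ring
    · simpa using hodd.symm
    · have : (1 : A) ≠ p⁻¹ := fun h => hp (inv_eq_one.1 h.symm)
      simp only [mem_insert, mem_singleton, not_or]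
      exact ⟨hp.symm, this⟩
  have := hm p
  omega

theorem stmt8 (hG : Fintype.card G = 225) (D : Finset G) :
    ¬ IsRegularPDS D 225 112 55 56 := by
  classical
  intro hD
  have hGn : Nat.card G = 225 := by rw [Nat.card_eq_fintype_card, hG]
  haveI : Fact (Nat.Prime 5) := ⟨by norm_num⟩
  haveI : Fact (Nat.Prime 3) := ⟨by norm_num⟩
  obtain ⟨H, hH⟩ := Sylow.exists_subgroup_card_pow_prime (G := G) 5 (n := 2)
    (by rw [hGn]; norm_num)
  have hA : Nat.card (G ⧸ H) = 9 := by
    have := H.card_eq_card_quotient_mul_card_subgroup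
    rw [hGn, hH] at this
    omega
  obtain ⟨p, hp⟩ := exists_prime_orderOf_dvd_card' (G := G ⧸ H) 3 (by rw [hA]; norm_num)
  have hB : Nat.card ((G ⧸ H) ⧸ Subgroup.zpowers p) = 3 := by
    have := (Subgroup.zpowers p).card_eq_card_quotient_mul_card_subgroup
    rw [hA, Nat.card_zpowers, hp] at this
    omega
  have hp3 : p ^ 3 = 1 := by rw [← hp]; exact pow_orderOf_eq_one p
  have hp1 : p ≠ 1 := by
    rintro rfl
    simp at hp
  haveI : Fintype (G ⧸ H) := Fintype.ofFinite _
  haveI : Fintype ((G ⧸ H) ⧸ Subgroup.zpowers p) := Fintype.ofFinite _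
  refine main_aux hG D hD (QuotientGroup.mk' H) (QuotientGroup.mk'_surjective H)
    (QuotientGroup.mk' (Subgroup.zpowers p)) (QuotientGroup.mk'_surjective _)
    (by rw [← Nat.card_eq_fintype_card, hA]) (by rw [← Nat.card_eq_fintype_card, hB]) p hp1 ?_ ?_
  · intro g hg
    have hg' : g ∈ H := (QuotientGroup.eq_one_iff g).1 hg
    have h := pow_card_eq_one' (x := (⟨g, hg'⟩ : H))
    rw [hH] at h
    simpa using congrArg Subtype.val h
  · intro a
    rw [QuotientGroup.mk'_apply, QuotientGroup.eq_one_iff]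
    constructor
    · intro h
      obtain ⟨n, hn, rfl⟩ := (mem_zpowers_iff_mem_range_orderOf).1 h |> mem_image.1
      rw [hp, mem_range] at hn
      interval_cases n
      · left; simp
      · right; left; simp
      · right; right
        exact eq_inv_of_mul_eq_one_left (by rw [← pow_succ]; exact hp3)
    · rintro (rfl | rfl | rfl)
      · exact one_mem _
      · exact Subgroup.mem_zpowers _
      · exact inv_mem (Subgroup.mem_zpowers _)
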